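/- Bernoulli sampling is (ε, δ)-robust against adaptive adversaries for a single set: fix R ⊆ U, 0 < ε, δ < 1, and stream length n. If each adaptively chosen stream element is independently included in the sample with probability p ≥ 10·(ln(4/δ))/(ε²n), then with probability at least 1 - δ, the final sample S (if nonempty) satisfies |d_R(X) - d_R(S)| ≤ ε, where X is the full stream. -/

import Mathlib

open MeasureTheory
open scoped Classical

open Finset in
/-- For `0/1`-valued `y i` with conditional mean `p` and predictable `0/1`-valued weights `c i`,
the exponential process compensated by `p * (exp l - 1) * c i` is adapted and integrable with
mean at most one. -/
lemma integral_exp_compensated_sum_le_one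
    {Ω : Type*} {m0 : MeasurableSpace Ω} {μ : Measure Ω} [IsProbabilityMeasure μ]
    (ℱ : Filtration ℕ m0) (p l : ℝ) (y c : ℕ → Ω → ℝ)
    (hy : ∀ i, Measurable[ℱ (i + 1)] (y i)) (hc : ∀ i, Measurable[ℱ i] (c i))
    (hy01 : ∀ i ω, y i ω = 0 ∨ y i ω = 1) (hc01 : ∀ i ω, c i ω = 0 ∨ c i ω = 1)
    (hmean : ∀ i, μ[y i | ℱ i] =ᵐ[μ] fun _ => p) (n : ℕ) :
    Measurable[ℱ n] (fun ω => Real.exp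
        (∑ i ∈ range n, (l * (y i ω * c i ω) - (Real.exp l - 1) * p * c i ω))) ∧
      Integrable (fun ω => Real.exp
        (∑ i ∈ range n, (l * (y i ω * c i ω) - (Real.exp l - 1) * p * c i ω))) μ ∧
      ∫ ω, Real.exp
        (∑ i ∈ range n, (l * (y i ω * c i ω) - (Real.exp l - 1) * p * c i ω)) ∂μ ≤ 1 := by
  induction n with
  | zero => simp
  | succ n ih =>
    set W : Ω → ℝ := fun ω => Real.exp
      (∑ i ∈ range n, (l * (y i ω * c i ω) - (Real.exp l - 1) * p * c i ω)) with hW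
    obtain ⟨hWm, hWi, hW1⟩ := ih
    set k := Real.exp l - 1 with hk
    set V : Ω → ℝ := fun ω => Real.exp (-(k * p * c n ω)) * W ω with hV
    have hcm : Measurable (c n) := (hc n).mono (ℱ.le n) le_rfl
    have hym : Measurable (y n) := (hy n).mono (ℱ.le (n + 1)) le_rfl
    have hc' : Measurable[ℱ (n + 1)] (c n) := (hc n).mono (ℱ.mono n.le_succ) le_rfl
    have hVm : Measurable[ℱ n] V :=
      ((((hc n).const_mul (k * p)).neg).exp).mul hWm
    have hVi : Integrable V μ := by
      refine hWi.bdd_mul (c := Real.exp |k * p|)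
        ((hcm.const_mul (k * p)).neg.exp).aestronglyMeasurable (.of_forall fun ω => ?_)
      rw [Real.norm_eq_abs, Real.abs_exp, Real.exp_le_exp]
      rcases hc01 n ω with h | h <;> rw [h]
      · rw [mul_zero, neg_zero]; exact abs_nonneg _
      · rw [mul_one]; exact neg_le_abs _
    have hcVi : Integrable (fun ω => c n ω * V ω) μ := by
      refine hVi.bdd_mul (c := 1) hcm.aestronglyMeasurable (.of_forall fun ω => ?_)
      rcases hc01 n ω with h | h <;> simp [h]
    have hcVy : Integrable (fun ω => y n ω * (c n ω * V ω)) μ := by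
      refine hcVi.bdd_mul (c := 1) hym.aestronglyMeasurable (.of_forall fun ω => ?_)
      rcases hy01 n ω with h | h <;> simp [h]
    have hyi : Integrable (y n) μ := by
      refine Integrable.of_bound hym.aestronglyMeasurable 1 (.of_forall fun ω => ?_)
      rcases hy01 n ω with h | h <;> simp [h]
    have hpull : ∫ ω, y n ω * (c n ω * V ω) ∂μ = p * ∫ ω, c n ω * V ω ∂μ := by
      have h1 : μ[(fun ω => y n ω * (c n ω * V ω)) | ℱ n] =ᵐ[μ]
          fun ω => p * (c n ω * V ω) := by
        have h2 := condExp_mul_of_stronglyMeasurable_right (m := ℱ n) (μ := μ) (f := y n)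
          (g := fun ω => c n ω * V ω) ((hc n).mul hVm).stronglyMeasurable hcVy hyi
        filter_upwards [h2, hmean n] with ω h2 h3
        rw [← h3]; exact h2
      rw [← integral_condExp (ℱ.le n), integral_congr_ae h1, integral_const_mul]
    have hstep : (fun ω => Real.exp
        (∑ i ∈ range (n + 1), (l * (y i ω * c i ω) - k * p * c i ω)))
        = fun ω => V ω + k * (y n ω * (c n ω * V ω)) := by
      funext ω
      rw [sum_range_succ, Real.exp_add, sub_eq_add_neg, Real.exp_add]
      have : Real.exp (l * (y n ω * c n ω)) = 1 + k * (y n ω * c n ω) := by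
        rcases hy01 n ω with h | h <;> rcases hc01 n ω with h' | h' <;> simp [h, h', hk]
      rw [this]
      simp only [hV, hW]
      ring
    rw [hstep]
    have hV' : Measurable[ℱ (n + 1)] V := hVm.mono (ℱ.mono n.le_succ) le_rfl
    refine ⟨hV'.add (((hy n).mul (hc'.mul hV')).const_mul k), hVi.add (hcVy.const_mul k), ?_⟩
    rw [integral_add hVi (hcVy.const_mul k), integral_const_mul, hpull, ← integral_const_mul,
      ← integral_const_mul, ← integral_add hVi ((hcVi.const_mul p).const_mul k)]
    refine le_trans (integral_mono (hVi.add ((hcVi.const_mul p).const_mul k)) hWi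
      fun ω => ?_) hW1
    have hexp := Real.add_one_le_exp (k * p * c n ω)
    have hVpos : 0 ≤ V ω := by positivity
    calc V ω + k * (p * (c n ω * V ω)) = (k * p * c n ω + 1) * V ω := by ring
      _ ≤ Real.exp (k * p * c n ω) * V ω := mul_le_mul_of_nonneg_right hexp hVpos
      _ = W ω := by
        simp only [hV]
        rw [← mul_assoc, ← Real.exp_add, add_neg_cancel, Real.exp_zero, one_mul]

open Finset in
/-- Chernoff bound for the centered sum `∑ i < n, (y i - p) * c i` of a predictably weighted
Bernoulli process; the sign of `l` selects the tail. -/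
lemma measureReal_le_mul_centered_sum_le
    {Ω : Type*} {m0 : MeasurableSpace Ω} {μ : Measure Ω} [IsProbabilityMeasure μ]
    (ℱ : Filtration ℕ m0) (p l t : ℝ) (hp : 0 ≤ p) (y c : ℕ → Ω → ℝ)
    (hy : ∀ i, Measurable[ℱ (i + 1)] (y i)) (hc : ∀ i, Measurable[ℱ i] (c i))
    (hy01 : ∀ i ω, y i ω = 0 ∨ y i ω = 1) (hc01 : ∀ i ω, c i ω = 0 ∨ c i ω = 1)
    (hmean : ∀ i, μ[y i | ℱ i] =ᵐ[μ] fun _ => p) (n : ℕ) :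
    μ.real {ω | t ≤ l * ∑ i ∈ range n, (y i ω - p) * c i ω} ≤
      Real.exp (p * n * (Real.exp l - 1 - l) - t) := by
  obtain ⟨-, hWi, hW1⟩ :=
    integral_exp_compensated_sum_le_one ℱ p l y c hy hc hy01 hc01 hmean n
  have hmarkov := mul_meas_ge_le_integral_of_nonneg (.of_forall fun ω => (Real.exp_pos _).le) hWi
    (Real.exp (t - p * n * (Real.exp l - 1 - l)))
  have hsub : {ω | t ≤ l * ∑ i ∈ range n, (y i ω - p) * c i ω} ⊆
      {ω | Real.exp (t - p * n * (Real.exp l - 1 - l)) ≤ Real.exp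
        (∑ i ∈ range n, (l * (y i ω * c i ω) - (Real.exp l - 1) * p * c i ω))} := by
    intro ω hω
    simp only [Set.mem_ofPred_eq, Real.exp_le_exp] at hω ⊢
    have hsum : ∑ i ∈ range n, (l * (y i ω * c i ω) - (Real.exp l - 1) * p * c i ω)
        = l * ∑ i ∈ range n, (y i ω - p) * c i ω
          - p * (Real.exp l - 1 - l) * ∑ i ∈ range n, c i ω := by
      rw [mul_sum, mul_sum, ← sum_sub_distrib]
      exact sum_congr rfl fun i _ => by ring
    have hcn : ∑ i ∈ range n, c i ω ≤ n := by
      calc ∑ i ∈ range n, c i ω ≤ ∑ _i ∈ range n, (1 : ℝ) :=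
            sum_le_sum fun i _ => by rcases hc01 i ω with h | h <;> simp [h]
        _ = n := by simp
    have hphi : 0 ≤ p * (Real.exp l - 1 - l) :=
      mul_nonneg hp (by linarith [Real.add_one_le_exp l])
    rw [hsum]
    nlinarith [mul_le_mul_of_nonneg_left hcn hphi]
  have h1 := (mul_le_mul_of_nonneg_left (measureReal_mono (μ := μ) hsub)
    (Real.exp_pos (t - p * n * (Real.exp l - 1 - l))).le).trans (hmarkov.trans hW1)
  rw [← neg_sub, Real.exp_neg, ← one_div, le_div_iff₀ (Real.exp_pos _), mul_comm]
  exact h1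

lemma exp_sub_one_sub_self_le {l : ℝ} (hl : |l| ≤ 2 / 5) :
    Real.exp l - 1 - l ≤ 5 / 8 * l ^ 2 := by
  have h := Real.exp_bound (x := l) (by linarith) (n := 3) (by norm_num)
  norm_num [Finset.sum_range_succ, Nat.factorial] at h
  have h3 : |l| ^ 3 ≤ 2 / 5 * l ^ 2 := by
    rw [← sq_abs l]
    nlinarith [sq_nonneg |l|, abs_nonneg l]
  nlinarith [(abs_le.mp h).2, sq_nonneg l]

open Finset in
/-- Two-sided deviation bound at scale `ε / 2` for predictably weighted Bernoulli sums. -/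
lemma measureReal_lt_abs_centered_sum_le
    {Ω : Type*} {m0 : MeasurableSpace Ω} {μ : Measure Ω} [IsProbabilityMeasure μ]
    (ℱ : Filtration ℕ m0) (p ε : ℝ) (hp : 0 ≤ p) (hε0 : 0 < ε) (hε1 : ε < 1) (y c : ℕ → Ω → ℝ)
    (hy : ∀ i, Measurable[ℱ (i + 1)] (y i)) (hc : ∀ i, Measurable[ℱ i] (c i))
    (hy01 : ∀ i ω, y i ω = 0 ∨ y i ω = 1) (hc01 : ∀ i ω, c i ω = 0 ∨ c i ω = 1)
    (hmean : ∀ i, μ[y i | ℱ i] =ᵐ[μ] fun _ => p) (n : ℕ) :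
    μ.real {ω | ε / 2 * (p * n) < |∑ i ∈ range n, (y i ω - p) * c i ω|} ≤
      2 * Real.exp (-(ε ^ 2 * (p * n) / 10)) := by
  have htail : ∀ l : ℝ, |l| = 2 / 5 * ε →
      μ.real {ω | 2 / 5 * ε * (ε / 2 * (p * n)) ≤ l * ∑ i ∈ range n, (y i ω - p) * c i ω} ≤
        Real.exp (-(ε ^ 2 * (p * n) / 10)) := by
    intro l hl
    refine (measureReal_le_mul_centered_sum_le ℱ p l _ hp y c hy hc hy01 hc01 hmean n).trans
      (Real.exp_le_exp.mpr ?_)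
    have hphi := exp_sub_one_sub_self_le (l := l) (by rw [hl]; linarith)
    rw [← sq_abs l, hl] at hphi
    have hpn : 0 ≤ p * n := by positivity
    nlinarith [mul_le_mul_of_nonneg_left hphi hpn]
  have hl : |2 / 5 * ε| = 2 / 5 * ε := abs_of_pos (by positivity)
  refine (measureReal_mono ?_).trans ((measureReal_union_le _ _).trans
    ((add_le_add (htail (2 / 5 * ε) hl) (htail (-(2 / 5 * ε)) (by rw [abs_neg, hl]))).trans_eq
      (two_mul _).symm))
  intro ω hω
  have hpos : 0 ≤ 2 / 5 * ε := by positivity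
  rw [Set.mem_ofPred_eq] at hω
  rcases lt_abs.mp hω with h | h
  · exact Or.inl (mul_le_mul_of_nonneg_left h.le hpos)
  · right
    simp only [Set.mem_ofPred_eq]
    rw [neg_mul_comm]
    exact mul_le_mul_of_nonneg_left h.le hpos

/-- If the sample size `k` and the sampled count `a` are within `ε / 2 * (p * n)` of
`p * n` and `p * A`, then the densities `A / n` and `a / k` differ by at most `ε`. -/
lemma abs_div_sub_div_le {n p ε A a k : ℝ} (hn : 0 < n) (hp : 0 < p)
    (hk : 0 < k) (ha : 0 ≤ a) (hak : a ≤ k)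
    (h1 : |a - p * A| ≤ ε / 2 * (p * n)) (h2 : |k - p * n| ≤ ε / 2 * (p * n)) :
    |A / n - a / k| ≤ ε := by
  have hpn : 0 < p * n := mul_pos hp hn
  have hq1 : a / k ≤ 1 := (div_le_one hk).mpr hak
  have hq0 : 0 ≤ a / k := by positivity
  have key : A / n - a / k = (a / k * (k - p * n) - (a - p * A)) / (p * n) := by
    field_simp
    ring
  rw [key, abs_div, abs_of_pos hpn, div_le_iff₀ hpn]
  calc |a / k * (k - p * n) - (a - p * A)|
      ≤ |a / k * (k - p * n)| + |a - p * A| := abs_sub _ _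
    _ ≤ 1 * |k - p * n| + |a - p * A| := by
        rw [abs_mul, abs_of_nonneg hq0]
        gcongr
    _ ≤ ε * (p * n) := by linarith

/-- Bernoulli sampling is `(ε, δ)`-robust against adaptive adversaries for a
single set `R`: the adversary chooses each stream element `x i` measurably in
the history `ℱ i`; the sampler includes it independently with probability
`p ≥ 10·ln(4/δ)/(ε²n)` (the indicator `s i` is `ℱ (i+1)`-measurable with
conditional expectation `p` given `ℱ i`). Then with probability at least
`1 - δ`, if the final sample is nonempty, its density of `R` is within `ε` of
the stream density: the bad event has probability at most `δ`. -/
theorem bernoulli_sampling_robust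
    {Ω : Type*} {m0 : MeasurableSpace Ω} {μ : Measure Ω} [IsProbabilityMeasure μ]
    {α : Type*} [MeasurableSpace α] (R : Set α) (hR : MeasurableSet R)
    (ℱ : Filtration ℕ m0)
    (n : ℕ) (hn : 0 < n) (ε δ : ℝ) (hε0 : 0 < ε) (hε1 : ε < 1)
    (hδ0 : 0 < δ) (hδ1 : δ < 1)
    (p : ℝ) (hp1 : p ≤ 1)
    (hp : 10 * Real.log (4 / δ) / (ε ^ 2 * n) ≤ p)
    (x : ℕ → Ω → α) (s : ℕ → Ω → Bool)
    (hx : ∀ i, Measurable[ℱ i] (x i))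
    (hs : ∀ i, Measurable[ℱ (i + 1)] (s i))
    (hbern : ∀ i,
      μ[(fun ω => if s i ω then (1 : ℝ) else 0) | ℱ i] =ᵐ[μ] fun _ => p) :
    μ {ω |
        0 < (((Finset.range n).filter fun i => s i ω = true).card) ∧
        ε < |((((Finset.range n).filter fun i => x i ω ∈ R).card : ℝ) / n) -
          ((((Finset.range n).filter fun i => s i ω = true ∧ x i ω ∈ R).card : ℝ) /
            (((Finset.range n).filter fun i => s i ω = true).card : ℝ))|}
      ≤ ENNReal.ofReal δ := by
  have hn' : (0 : ℝ) < n := by exact_mod_cast hn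
  have hlog : 0 < Real.log (4 / δ) := Real.log_pos (by rw [lt_div_iff₀ hδ0]; linarith)
  have hp0 : 0 < p := lt_of_lt_of_le (by positivity) hp
  have hexp : Real.exp (-(ε ^ 2 * (p * n) / 10)) ≤ δ / 4 := by
    rw [div_le_iff₀ (by positivity)] at hp
    calc Real.exp (-(ε ^ 2 * (p * n) / 10)) ≤ Real.exp (-Real.log (4 / δ)) :=
          Real.exp_le_exp.mpr (by linarith)
      _ = δ / 4 := by rw [Real.exp_neg, Real.exp_log (by positivity), inv_div]
  set y : ℕ → Ω → ℝ := fun i ω => if s i ω then (1 : ℝ) else 0 with hy_def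
  set c : ℕ → Ω → ℝ := fun i ω => if x i ω ∈ R then (1 : ℝ) else 0 with hc_def
  have hy : ∀ i, Measurable[ℱ (i + 1)] (y i) := fun i =>
    (measurable_of_countable fun b : Bool => if b then (1 : ℝ) else 0).comp (hs i)
  have hc : ∀ i, Measurable[ℱ i] (c i) := fun i =>
    Measurable.ite (hx i hR) measurable_const measurable_const
  have hy01 : ∀ i ω, y i ω = 0 ∨ y i ω = 1 := fun i ω => by
    by_cases h : s i ω = true <;> simp [hy_def, h]
  have hc01 : ∀ i ω, c i ω = 0 ∨ c i ω = 1 := fun i ω => by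
    by_cases h : x i ω ∈ R <;> simp [hc_def, h]
  have hR_dev := measureReal_lt_abs_centered_sum_le ℱ p ε hp0.le hε0 hε1 y c hy hc hy01 hc01
    hbern n
  have hsize_dev := measureReal_lt_abs_centered_sum_le ℱ p ε hp0.le hε0 hε1 y (fun _ _ => 1) hy
    (fun _ => measurable_const) hy01 (fun _ _ => Or.inr rfl) hbern n
  rw [← ofReal_measureReal]
  refine ENNReal.ofReal_le_ofReal ((measureReal_mono ?_).trans
    ((measureReal_union_le _ _).trans ((add_le_add hR_dev hsize_dev).trans (by linarith))))
  rintro ω ⟨hpos, hbad⟩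
  by_contra hgood
  simp only [Set.mem_union, Set.mem_ofPred_eq, not_or, not_lt] at hgood
  refine hbad.not_ge (abs_div_sub_div_le hn' hp0 (by exact_mod_cast hpos) (by positivity) ?_ ?_ ?_)
  · refine Nat.cast_le.mpr (Finset.card_le_card fun i hi => ?_)
    rw [Finset.mem_filter] at hi ⊢
    exact ⟨hi.1, hi.2.1⟩
  · refine le_of_eq_of_le (congrArg _ ?_) hgood.1
    simp only [Finset.card_filter, Nat.cast_sum, Finset.mul_sum, ← Finset.sum_sub_distrib]
    refine Finset.sum_congr rfl fun i _ => ?_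
    by_cases h : s i ω = true <;> by_cases h' : x i ω ∈ R <;> simp [hy_def, hc_def, h, h']
  · refine le_of_eq_of_le (congrArg _ ?_) hgood.2
    simp [hy_def, Finset.sum_sub_distrib, mul_comm]
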